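/- Dimension lower bound for quantum automata recognizing L_n (core of part 3 of Theorems 1 and 2): Let 1/2 < p ≤ 1, let U₀ and U₁ be unitary d×d complex matrices, and let P be a d×d orthogonal projection. Let ρ₀ = |ψ⟩⟨ψ| for some unit vector ψ ∈ ℂ^d, and define recursively ρ_k = ½(U₀ ρ_{k−1} U₀† + U₁ ρ_{k−1} U₁†). Suppose that for every k with 0 ≤ k < n, Tr((I − P) U₀ ρ_k U₀†) ≥ p and Tr(P U₁ ρ_k U₁†) ≥ p. Then d ≥ 2^{(1 − H(p))·n}. -/

import Mathlib

open Matrix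
open scoped ComplexOrder

/-- The binary entropy function `H(p) = −p log₂ p − (1−p) log₂ (1−p)`. -/
noncomputable def binH (p : ℝ) : ℝ :=
  -(p * Real.logb 2 p) - (1 - p) * Real.logb 2 (1 - p)

section ConjDiagonal

variable {ι : Type*} [Fintype ι] [DecidableEq ι]

/-- The matrix `V diag(l) Vᴴ`; for unitary `V` it has eigenvalues `l` and eigenvectors the columns
of `V`. -/
noncomputable def conjDiagonal (V : Matrix ι ι ℂ) (l : ι → ℝ) : Matrix ι ι ℂ :=
  V * diagonal (fun i => (l i : ℂ)) * Vᴴ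

lemma mul_conjDiagonal_mul_conjTranspose (U V : Matrix ι ι ℂ) (l : ι → ℝ) :
    U * conjDiagonal V l * Uᴴ = conjDiagonal (U * V) l := by
  simp only [conjDiagonal, conjTranspose_mul, Matrix.mul_assoc]

lemma re_trace_diagonal_mul_conjTranspose_mul (l : ι → ℝ) (A B : Matrix ι ι ℂ) :
    (diagonal (fun i => (l i : ℂ)) * (Aᴴ * B)).trace.re =
      ∑ j, ∑ i, l i * (star (A j i) * B j i).re := by
  rw [Finset.sum_comm]
  simp only [trace, diag_apply, diagonal_mul, mul_apply (M := Aᴴ), Complex.re_sum,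
    Complex.re_ofReal_mul, conjTranspose_apply, Finset.mul_sum]

lemma re_trace_diagonal_mul_self_conjTranspose (m : ι → ℝ) (A : Matrix ι ι ℂ) :
    (diagonal (fun i => (m i : ℂ)) * (A * Aᴴ)).trace.re =
      ∑ j, ∑ i, m j * Complex.normSq (A j i) := by
  simp only [trace, diag_apply, diagonal_mul, mul_apply (M := A), Complex.re_sum,
    Complex.re_ofReal_mul, conjTranspose_apply, Finset.mul_sum]
  refine Finset.sum_congr rfl fun j _ => Finset.sum_congr rfl fun i _ => ?_
  rw [Complex.star_def, Complex.mul_conj, Complex.ofReal_re]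

lemma trace_conjDiagonal {V : Matrix ι ι ℂ} (hV : V ∈ unitaryGroup ι ℂ) (l : ι → ℝ) :
    (conjDiagonal V l).trace = ∑ i, (l i : ℂ) := by
  rw [conjDiagonal, trace_mul_comm, ← Matrix.mul_assoc, ← star_eq_conjTranspose,
    mem_unitaryGroup_iff'.1 hV, Matrix.one_mul, trace_diagonal]

lemma sum_normSq_row_mul (V W : Matrix ι ι ℂ) (l : ι → ℝ) (j : ι) :
    ∑ i, Complex.normSq ((Wᴴ * V) j i) * l i = ((Wᴴ * conjDiagonal V l * W) j j).re := by
  have h : Wᴴ * conjDiagonal V l * W =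
      (Wᴴ * V) * diagonal (fun i => (l i : ℂ)) * (Wᴴ * V)ᴴ := by
    simp only [conjDiagonal, conjTranspose_mul, conjTranspose_conjTranspose, Matrix.mul_assoc]
  rw [h, mul_apply, Complex.re_sum]
  refine Finset.sum_congr rfl fun i _ => ?_
  rw [mul_diagonal, conjTranspose_apply, Complex.star_def, mul_right_comm, Complex.mul_conj,
    ← Complex.ofReal_mul, Complex.ofReal_re]

lemma sum_normSq_col_of_mem_unitaryGroup {C : Matrix ι ι ℂ} (hC : C ∈ unitaryGroup ι ℂ) (i : ι) :
    ∑ j, Complex.normSq (C j i) = 1 := by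
  have h := congrFun (congrFun (mem_unitaryGroup_iff'.1 hC) i) i
  rw [star_eq_conjTranspose, mul_apply, one_apply_eq] at h
  have h' := congrArg Complex.re h
  rw [Complex.re_sum, Complex.one_re] at h'
  rw [← h']
  refine Finset.sum_congr rfl fun j _ => ?_
  rw [conjTranspose_apply, Complex.star_def, ← Complex.normSq_eq_conj_mul_self, Complex.ofReal_re]

lemma exists_eq_conjDiagonal {A : Matrix ι ι ℂ} (hA : A.PosSemidef) (htr : A.trace = 1) :
    ∃ V ∈ unitaryGroup ι ℂ, ∃ l : ι → ℝ,
      (∀ i, 0 ≤ l i) ∧ ∑ i, l i = 1 ∧ A = conjDiagonal V l := by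
  refine ⟨hA.1.eigenvectorUnitary, hA.1.eigenvectorUnitary.2, hA.1.eigenvalues,
    hA.eigenvalues_nonneg, ?_, ?_⟩
  · have h := hA.1.trace_eq_sum_eigenvalues
    rw [htr] at h
    simpa using congrArg Complex.re h.symm
  · have h := hA.1.spectral_theorem
    rw [Unitary.conjStarAlgAut_apply] at h
    exact h

end ConjDiagonal

lemma two_mul_re_sub_le_normSq_mul (c x : ℂ) {l m t : ℝ} (hl : 0 ≤ l) (hm : 0 ≤ m) (ht : 0 < t) :
    2 * (l * (star c * x).re) - m * Complex.normSq x - t * (l * Complex.normSq x) ≤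
      Complex.normSq c * l * (l / (m + t * l)) := by
  have htl : 0 ≤ t * l := by positivity
  rcases (add_nonneg hm htl).eq_or_lt with h | h
  · have hm0 : m = 0 := by linarith
    have hl0 : l = 0 := by
      have : t * l = 0 := by linarith
      exact (mul_eq_zero.1 this).resolve_left ht.ne'
    simp [hm0, hl0]
  · rw [← mul_div_assoc, le_div_iff₀ h]
    simp only [Complex.normSq_apply, Complex.star_def, Complex.mul_re, Complex.conj_re,
      Complex.conj_im]
    nlinarith [sq_nonneg (l * c.re - (m + t * l) * x.re), sq_nonneg (l * c.im - (m + t * l) * x.im)]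

section RelativeEntropy

variable {ι : Type*} [Fintype ι] [DecidableEq ι]

/-- Variational lower bound for the resolvent of the relative modular operator, with an arbitrary
Hermitian trial operator `X`. -/
lemma re_trace_trial_le {V W : Matrix ι ι ℂ} (hV : V ∈ unitaryGroup ι ℂ)
    (hW : W ∈ unitaryGroup ι ℂ) {l m : ι → ℝ} (hl : ∀ i, 0 ≤ l i) (hm : ∀ i, 0 ≤ m i)
    {X : Matrix ι ι ℂ} (hX : X.IsHermitian) {t : ℝ} (ht : 0 < t) :
    2 * (X * conjDiagonal V l).trace.re - (X * X * conjDiagonal W m).trace.re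
        - t * (X * X * conjDiagonal V l).trace.re ≤
      ∑ j, ∑ i, Complex.normSq ((Wᴴ * V) j i) * l i * (l i / (m j + t * l i)) := by
  have hV' : V * Vᴴ = 1 := mem_unitaryGroup_iff.1 hV
  have hW' : W * Wᴴ = 1 := mem_unitaryGroup_iff.1 hW
  have hWW (A B : Matrix ι ι ℂ) : A * (W * (Wᴴ * B)) = A * B := by
    rw [← Matrix.mul_assoc W, hW', Matrix.one_mul]
  have hVV (A B : Matrix ι ι ℂ) : A * (V * (Vᴴ * B)) = A * B := by
    rw [← Matrix.mul_assoc V, hV', Matrix.one_mul]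
  set Y : Matrix ι ι ℂ := Wᴴ * X * V with hY
  have cyc (Z U D : Matrix ι ι ℂ) : (Z * (U * D * Uᴴ)).trace = (D * (Uᴴ * Z * U)).trace := by
    rw [trace_mul_comm, Matrix.mul_assoc, Matrix.mul_assoc, trace_mul_comm]
    simp only [Matrix.mul_assoc]
  have h1 : (X * conjDiagonal V l).trace.re =
      ∑ j, ∑ i, l i * (star ((Wᴴ * V) j i) * Y j i).re := by
    rw [← re_trace_diagonal_mul_conjTranspose_mul, conjDiagonal, cyc]
    simp only [hY, conjTranspose_mul, conjTranspose_conjTranspose, Matrix.mul_assoc, hWW]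
  have h2 : (X * X * conjDiagonal W m).trace.re = ∑ j, ∑ i, m j * Complex.normSq (Y j i) := by
    rw [← re_trace_diagonal_mul_self_conjTranspose, conjDiagonal, cyc]
    simp only [hY, conjTranspose_mul, conjTranspose_conjTranspose, Matrix.mul_assoc, hVV, hX.eq]
  have h3 : (X * X * conjDiagonal V l).trace.re = ∑ j, ∑ i, l i * Complex.normSq (Y j i) := by
    have h := re_trace_diagonal_mul_conjTranspose_mul l Y Y
    simp only [Complex.star_def, ← Complex.normSq_eq_conj_mul_self, Complex.ofReal_re] at h
    rw [← h, conjDiagonal, cyc]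
    simp only [hY, conjTranspose_mul, conjTranspose_conjTranspose, Matrix.mul_assoc, hWW, hX.eq]
  rw [h1, h2, h3]
  simp only [Finset.mul_sum, ← Finset.sum_sub_distrib]
  exact Finset.sum_le_sum fun j _ => Finset.sum_le_sum fun i _ =>
    two_mul_re_sub_le_normSq_mul _ _ (hl i) (hm j) ht

lemma hasDerivAt_trial_integral {s t : ℝ} (hs : 0 < s) (ht : 0 ≤ t) (p q : ℝ) :
    HasDerivAt (fun t => p * (Real.log (s + t) - s * (s + t)⁻¹) + q * (s + t)⁻¹)
      (2 * (p * (s + t)⁻¹) - q * (s + t)⁻¹ ^ 2 - t * (p * (s + t)⁻¹ ^ 2)) t := by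
  have h0 : s + t ≠ 0 := by positivity
  have h1 : HasDerivAt (fun t => s + t) 1 t := (hasDerivAt_id t).const_add s
  have h2 := h1.log h0
  have h3 := h1.inv h0
  refine (((h2.sub (h3.const_mul s)).const_mul p).add (h3.const_mul q)).congr_deriv ?_
  field_simp
  ring

open Filter Topology in
lemma tendsto_log_add_mul_sub_log (m : ℝ) {l : ℝ} (hl : 0 < l) :
    Tendsto (fun t => Real.log (m + t * l) - Real.log t) atTop (𝓝 (Real.log l)) := by
  have h : Tendsto (fun t : ℝ => m * t⁻¹ + l) atTop (𝓝 l) := by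
    simpa using (tendsto_inv_atTop_zero.const_mul m).add_const l
  refine (h.log hl.ne').congr' ?_
  filter_upwards [h.eventually (lt_mem_nhds hl), eventually_gt_atTop 0] with t h1 h2
  have h3 : m + t * l = (m * t⁻¹ + l) * t := by field_simp
  rw [h3, Real.log_mul h1.ne' h2.ne']
  ring

open Filter Topology in
/-- Integrated form of a family of resolvent inequalities. -/
lemma trial_le_sum_mul_log {α κ : Type*} [Fintype α] [Fintype κ] {a l m : α → ℝ}
    (hl : ∀ i, a i ≠ 0 → 0 < l i) (hm : ∀ i, a i ≠ 0 → 0 < m i) {p q s : κ → ℝ}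
    (hs : ∀ k, 0 < s k) (hap : ∑ i, a i = ∑ k, p k)
    (h : ∀ t, 0 < t → ∑ k, (2 * (p k * (s k + t)⁻¹) - q k * (s k + t)⁻¹ ^ 2
      - t * (p k * (s k + t)⁻¹ ^ 2)) ≤ ∑ i, a i * (l i / (m i + t * l i))) :
    ∑ k, (p k * (1 - Real.log (s k)) - q k * (s k)⁻¹) ≤
      ∑ i, a i * (Real.log (l i) - Real.log (m i)) := by
  let F : ℝ → ℝ := fun t => ∑ i, a i * Real.log (m i + t * l i)
    - ∑ k, (p k * (Real.log (s k + t) - s k * (s k + t)⁻¹) + q k * (s k + t)⁻¹)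
  have hF (t : ℝ) (ht : 0 ≤ t) : HasDerivAt F (∑ i, a i * (l i / (m i + t * l i))
      - ∑ k, (2 * (p k * (s k + t)⁻¹) - q k * (s k + t)⁻¹ ^ 2
      - t * (p k * (s k + t)⁻¹ ^ 2))) t := by
    refine HasDerivAt.sub (HasDerivAt.fun_sum fun i _ => ?_)
      (HasDerivAt.fun_sum fun k _ => hasDerivAt_trial_integral (hs k) ht _ _)
    by_cases hai : a i = 0
    · simpa [hai] using hasDerivAt_const t (0 : ℝ)
    · have h0 : m i + t * l i ≠ 0 := by
        have := hl i hai; have := hm i hai; positivity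
      have h1 : HasDerivAt (fun t => m i + t * l i) (l i) t := by
        simpa using ((hasDerivAt_id t).mul_const (l i)).const_add (m i)
      exact (h1.log h0).const_mul (a i)
  have hmono : MonotoneOn F (Set.Ici 0) := by
    refine monotoneOn_of_deriv_nonneg (convex_Ici 0)
      (fun t ht => (hF t ht).continuousAt.continuousWithinAt)
      (fun t ht => (hF t (interior_subset ht)).differentiableAt.differentiableWithinAt) ?_
    intro t ht
    rw [interior_Ici] at ht
    rw [(hF t (le_of_lt ht)).deriv, sub_nonneg]
    exact h t ht
  have hlim : Tendsto F atTop (𝓝 (∑ i, a i * Real.log (l i))) := by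
    have hG : Tendsto (fun t => ∑ i, a i * (Real.log (m i + t * l i) - Real.log t)
        - ∑ k, (p k * ((Real.log (s k + t * 1) - Real.log t) - s k * (s k + t)⁻¹)
          + q k * (s k + t)⁻¹)) atTop
        (𝓝 (∑ i, a i * Real.log (l i)
          - ∑ k, (p k * (Real.log 1 - s k * 0) + q k * 0))) := by
      refine (tendsto_finsetSum _ fun i _ => ?_).sub (tendsto_finsetSum _ fun k _ => ?_)
      · by_cases hai : a i = 0
        · simp [hai]
        · exact (tendsto_log_add_mul_sub_log _ (hl i hai)).const_mul _
      · have hi : Tendsto (fun t => (s k + t)⁻¹) atTop (𝓝 0) :=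
          tendsto_inv_atTop_zero.comp (tendsto_atTop_add_const_left _ _ tendsto_id)
        exact (((tendsto_log_add_mul_sub_log _ one_pos).sub (hi.const_mul _)).const_mul _).add
          (hi.const_mul _)
    simp only [Real.log_one, mul_zero, sub_zero, add_zero, Finset.sum_const_zero] at hG
    refine hG.congr fun t => ?_
    simp only [F, mul_sub, mul_one, Finset.sum_sub_distrib, Finset.sum_add_distrib,
      ← Finset.sum_mul, hap]
    ring
  have hfin := ge_of_tendsto hlim ((eventually_ge_atTop 0).mono fun t ht =>
    hmono Set.self_mem_Ici ht ht)
  have hF0 : F 0 = ∑ i, a i * Real.log (m i)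
      + ∑ k, (p k * (1 - Real.log (s k)) - q k * (s k)⁻¹) := by
    simp only [F, zero_mul, add_zero, sub_eq_add_neg, ← Finset.sum_neg_distrib]
    congr 1
    refine Finset.sum_congr rfl fun k _ => ?_
    rw [mul_inv_cancel₀ (hs k).ne']
    ring
  simp only [mul_sub (a _), Finset.sum_sub_distrib (f := fun i => a i * Real.log (l i))]
  linarith

/-- Lower bound for the relative entropy of `conjDiagonal V l` with respect to `conjDiagonal W m`
in terms of the outcome probabilities of the projective measurement `{P, 1 - P}`. -/
lemma measurement_le_relative_entropy {V W : Matrix ι ι ℂ} (hV : V ∈ unitaryGroup ι ℂ)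
    (hW : W ∈ unitaryGroup ι ℂ) {l m : ι → ℝ} (hl : ∀ i, 0 ≤ l i) (hm : ∀ i, 0 ≤ m i)
    (hsupp : ∀ j i, m j = 0 → Complex.normSq ((Wᴴ * V) j i) * l i = 0)
    {P : Matrix ι ι ℂ} (hPh : P.IsHermitian) (hP2 : P * P = P)
    {s r : ℝ} (hs : 0 < s) (hr : 0 < r) :
    ((P * conjDiagonal V l).trace.re * (1 - Real.log s) - (P * conjDiagonal W m).trace.re * s⁻¹)
      + (((1 - P) * conjDiagonal V l).trace.re * (1 - Real.log r)
        - ((1 - P) * conjDiagonal W m).trace.re * r⁻¹) ≤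
      ∑ i, l i * Real.log (l i)
        - ∑ j, (∑ i, Complex.normSq ((Wᴴ * V) j i) * l i) * Real.log (m j) := by
  have hC : Wᴴ * V ∈ unitaryGroup ι ℂ := mul_mem (Unitary.star_mem hW) hV
  have hcol (f : ι → ℝ) : ∑ j, ∑ i, Complex.normSq ((Wᴴ * V) j i) * f i = ∑ i, f i := by
    rw [Finset.sum_comm]
    simp only [← Finset.sum_mul, sum_normSq_col_of_mem_unitaryGroup hC, one_mul]
  have key := trial_le_sum_mul_log (α := ι × ι) (κ := Bool)
    (a := fun x => Complex.normSq ((Wᴴ * V) x.1 x.2) * l x.2) (l := fun x => l x.2)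
    (m := fun x => m x.1)
    (p := fun b => (cond b P (1 - P) * conjDiagonal V l).trace.re)
    (q := fun b => (cond b P (1 - P) * conjDiagonal W m).trace.re)
    (s := fun b => cond b s r)
    (fun x hx => (hl _).lt_of_ne' (right_ne_zero_of_mul hx))
    (fun x hx => (hm _).lt_of_ne' fun h0 => hx (hsupp _ _ h0))
    (by rintro (_ | _) <;> assumption) ?_ ?_
  · simp only [Fintype.sum_bool, cond_true, cond_false, Fintype.sum_prod_type, mul_sub,
      Finset.sum_sub_distrib, mul_assoc, hcol] at key
    simp only [Finset.sum_mul, mul_assoc]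
    linarith
  · rw [Fintype.sum_prod_type, hcol]
    simp only [Fintype.sum_bool, cond_true, cond_false]
    rw [← Complex.add_re, ← trace_add, ← Matrix.add_mul, add_sub_cancel, Matrix.one_mul,
      trace_conjDiagonal hV, ← Complex.ofReal_sum, Complex.ofReal_re]
  · intro t ht
    have hx (x y : ℝ) : ((x : ℂ) • P + (y : ℂ) • (1 - P)).IsHermitian := by
      simp only [IsHermitian, conjTranspose_add, conjTranspose_smul, conjTranspose_sub,
        conjTranspose_one, hPh.eq, Complex.star_def, Complex.conj_ofReal]
    have hsq (x y : ℝ) : ((x : ℂ) • P + (y : ℂ) • (1 - P)) * ((x : ℂ) • P + (y : ℂ) • (1 - P)) =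
        ((x ^ 2 : ℝ) : ℂ) • P + ((y ^ 2 : ℝ) : ℂ) • (1 - P) := by
      simp only [Matrix.add_mul, Matrix.mul_add, smul_mul_assoc, mul_smul_comm, Matrix.mul_sub,
        Matrix.sub_mul, Matrix.one_mul, Matrix.mul_one, hP2, sub_self, smul_zero]
      push_cast
      module
    have hlin (x y : ℝ) (Z : Matrix ι ι ℂ) : (((x : ℂ) • P + (y : ℂ) • (1 - P)) * Z).trace.re =
        x * (P * Z).trace.re + y * ((1 - P) * Z).trace.re := by
      rw [Matrix.add_mul, trace_add, smul_mul_assoc, smul_mul_assoc, trace_smul, trace_smul,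
        Complex.add_re, smul_eq_mul, smul_eq_mul, Complex.re_ofReal_mul, Complex.re_ofReal_mul]
    have h := re_trace_trial_le hV hW hl hm (hx (s + t)⁻¹ (r + t)⁻¹) ht
    simp only [hsq, hlin] at h
    rw [Fintype.sum_prod_type]
    simp only [Fintype.sum_bool, cond_true, cond_false]
    refine le_trans (le_of_eq ?_) h
    ring

end RelativeEntropy

lemma le_half_sum_log {a b c d p : ℝ} (hp : 1 / 2 < p) (hp1 : p < 1) (hab : a + b = 1)
    (hcd : c + d = 1) (hb : p ≤ b) (hc : p ≤ c) :
    Real.log 2 - Real.binEntropy p ≤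
      1 / 2 * (a * Real.log (2 * (1 - p)) + b * Real.log (2 * p)
        + (c * Real.log (2 * p) + d * Real.log (2 * (1 - p)))) := by
  have hlog : Real.log (1 - p) ≤ Real.log p := Real.log_le_log (by linarith) (by linarith)
  obtain rfl : a = 1 - b := by linarith
  obtain rfl : d = 1 - c := by linarith
  rw [Real.log_mul two_ne_zero (by linarith), Real.log_mul two_ne_zero (by linarith),
    Real.binEntropy, Real.log_inv, Real.log_inv]
  nlinarith [mul_nonneg (sub_nonneg.2 hb) (sub_nonneg.2 hlog),
    mul_nonneg (sub_nonneg.2 hc) (sub_nonneg.2 hlog)]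

section Entropy

variable {ι : Type*} [Fintype ι] [DecidableEq ι]

/-- Mixing two states with spectrum `l` that are distinguished with probability at least `p` by a
projective measurement increases the entropy by at least `log 2 - binEntropy p`. -/
lemma entropy_add_le_entropy_mixture {V₀ V₁ W : Matrix ι ι ℂ} (hV₀ : V₀ ∈ unitaryGroup ι ℂ)
    (hV₁ : V₁ ∈ unitaryGroup ι ℂ) (hW : W ∈ unitaryGroup ι ℂ) {l m : ι → ℝ}
    (hl : ∀ i, 0 ≤ l i) (hm : ∀ i, 0 ≤ m i) (hl1 : ∑ i, l i = 1)
    (hmix : conjDiagonal W m = (1 / 2 : ℂ) • (conjDiagonal V₀ l + conjDiagonal V₁ l))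
    {P : Matrix ι ι ℂ} (hPh : P.IsHermitian) (hP2 : P * P = P)
    {p : ℝ} (hp : 1 / 2 < p) (hp1 : p < 1)
    (h₀ : p ≤ ((1 - P) * conjDiagonal V₀ l).trace.re)
    (h₁ : p ≤ (P * conjDiagonal V₁ l).trace.re) :
    ∑ i, Real.negMulLog (l i) + (Real.log 2 - Real.binEntropy p) ≤
      ∑ i, Real.negMulLog (m i) := by
  have hWW : Wᴴ * W = 1 := mem_unitaryGroup_iff'.1 hW
  have hrow (j : ι) : m j = 1 / 2 * (∑ i, Complex.normSq ((Wᴴ * V₀) j i) * l i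
      + ∑ i, Complex.normSq ((Wᴴ * V₁) j i) * l i) := by
    have h : Wᴴ * conjDiagonal W m * W = diagonal (fun i => (m i : ℂ)) := by
      rw [conjDiagonal, Matrix.mul_assoc, Matrix.mul_assoc, Matrix.mul_assoc, hWW, Matrix.mul_one,
        ← Matrix.mul_assoc, hWW, Matrix.one_mul]
    have h' := congrArg Complex.re (congrFun (congrFun h j) j)
    rw [diagonal_apply_eq, Complex.ofReal_re] at h'
    rw [sum_normSq_row_mul, sum_normSq_row_mul, ← h', hmix, mul_smul_comm, smul_mul_assoc,
      Matrix.mul_add, Matrix.add_mul, Matrix.smul_apply, Matrix.add_apply, smul_eq_mul, ← Complex.add_re]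
    norm_num
  have hnn (V : Matrix ι ι ℂ) (j i : ι) : 0 ≤ Complex.normSq ((Wᴴ * V) j i) * l i :=
    mul_nonneg (Complex.normSq_nonneg _) (hl i)
  have hsum (V : Matrix ι ι ℂ) (j : ι) : 0 ≤ ∑ i, Complex.normSq ((Wᴴ * V) j i) * l i :=
    Finset.sum_nonneg fun i _ => hnn V j i
  have hzero (V : Matrix ι ι ℂ) (j i : ι)
      (h : ∑ i, Complex.normSq ((Wᴴ * V) j i) * l i ≤ 0) :
      Complex.normSq ((Wᴴ * V) j i) * l i = 0 :=
    (Finset.sum_eq_zero_iff_of_nonneg fun i _ => hnn V j i).1 (h.antisymm (hsum V j)) i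
      (Finset.mem_univ i)
  have htr {V : Matrix ι ι ℂ} (hV : V ∈ unitaryGroup ι ℂ) :
      (P * conjDiagonal V l).trace.re + ((1 - P) * conjDiagonal V l).trace.re = 1 := by
    rw [← Complex.add_re, ← trace_add, ← Matrix.add_mul, add_sub_cancel, Matrix.one_mul,
      trace_conjDiagonal hV, ← Complex.ofReal_sum, Complex.ofReal_re, hl1]
  have hmixtr (Z : Matrix ι ι ℂ) : (Z * conjDiagonal W m).trace.re =
      1 / 2 * ((Z * conjDiagonal V₀ l).trace.re + (Z * conjDiagonal V₁ l).trace.re) := by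
    rw [hmix, mul_smul_comm, trace_smul, Matrix.mul_add, trace_add, smul_eq_mul, ← Complex.add_re]
    norm_num
  have hs : (0 : ℝ) < (2 * (1 - p))⁻¹ := inv_pos.2 (by linarith)
  have hr : (0 : ℝ) < (2 * p)⁻¹ := inv_pos.2 (by linarith)
  have D₀ := measurement_le_relative_entropy hV₀ hW hl hm (fun j i hj => hzero V₀ j i (by
    linarith [hrow j, hsum V₁ j])) hPh hP2 hs hr
  have D₁ := measurement_le_relative_entropy hV₁ hW hl hm (fun j i hj => hzero V₁ j i (by
    linarith [hrow j, hsum V₀ j])) hPh hP2 hr hs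
  have hS : ∑ j, Real.negMulLog (m j) =
      -(1 / 2 * (∑ j, (∑ i, Complex.normSq ((Wᴴ * V₀) j i) * l i) * Real.log (m j)
        + ∑ j, (∑ i, Complex.normSq ((Wᴴ * V₁) j i) * l i) * Real.log (m j))) := by
    rw [← Finset.sum_add_distrib, Finset.mul_sum, ← Finset.sum_neg_distrib]
    refine Finset.sum_congr rfl fun j _ => ?_
    rw [← add_mul, ← mul_assoc, ← hrow j, Real.negMulLog, neg_mul]
  have hSl : ∑ i, Real.negMulLog (l i) = -∑ i, l i * Real.log (l i) := by
    simp only [Real.negMulLog, neg_mul, Finset.sum_neg_distrib]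
  have hlog := le_half_sum_log hp hp1 (htr hV₀) (htr hV₁) h₀ h₁
  have t₀ := htr hV₀
  have t₁ := htr hV₁
  simp only [Real.log_inv, inv_inv, hmixtr] at D₀ D₁
  rw [hS, hSl]
  generalize (P * conjDiagonal V₀ l).trace.re = a at *
  generalize ((1 - P) * conjDiagonal V₀ l).trace.re = b at *
  generalize (P * conjDiagonal V₁ l).trace.re = c at *
  generalize ((1 - P) * conjDiagonal V₁ l).trace.re = e at *
  obtain rfl : a = 1 - b := by linarith
  obtain rfl : e = 1 - c := by linarith
  linarith

end Entropy

lemma sum_negMulLog_le_log_card {ι : Type*} [Fintype ι] [Nonempty ι] {l : ι → ℝ} (hl : ∀ i, 0 ≤ l i)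
    (hl1 : ∑ i, l i = 1) : ∑ i, Real.negMulLog (l i) ≤ Real.log (Fintype.card ι) := by
  have hd : (0 : ℝ) < Fintype.card ι := by exact_mod_cast Fintype.card_pos
  have h : ∑ i, Real.negMulLog (Fintype.card ι * l i) ≤ ∑ i, (1 - Fintype.card ι * l i) :=
    Finset.sum_le_sum fun i _ => Real.negMulLog_le_one_sub_self (by have := hl i; positivity)
  simp only [Real.negMulLog_mul, Finset.sum_add_distrib, Finset.sum_sub_distrib, ← Finset.sum_mul,
    ← Finset.mul_sum, hl1, Finset.sum_const, Finset.card_univ, nsmul_eq_mul, mul_one, one_mul,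
    sub_self] at h
  rw [Real.negMulLog] at h
  have h' : (Fintype.card ι : ℝ) * (∑ i, Real.negMulLog (l i) - Real.log (Fintype.card ι)) ≤ 0 := by
    linarith
  linarith [nonpos_of_mul_nonpos_right h' hd]

lemma binH_mul_log_two (p : ℝ) : binH p * Real.log 2 = Real.binEntropy p := by
  have h : Real.log 2 ≠ 0 := (Real.log_pos one_lt_two).ne'
  simp only [binH, Real.logb, Real.binEntropy, Real.log_inv]
  field_simp
  ring

lemma natCast_mul_le_log_dimension {d n : ℕ} {p : ℝ} (hp : 1 / 2 < p) (hp1 : p < 1)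
    {U₀ U₁ : Matrix (Fin d) (Fin d) ℂ}
    (hU₀ : U₀ ∈ unitaryGroup (Fin d) ℂ) (hU₁ : U₁ ∈ unitaryGroup (Fin d) ℂ)
    {P : Matrix (Fin d) (Fin d) ℂ} (hPh : P.IsHermitian) (hP2 : P * P = P)
    {ρ : ℕ → Matrix (Fin d) (Fin d) ℂ} (hρ0 : (ρ 0).PosSemidef) (htr0 : (ρ 0).trace = 1)
    (hrec : ∀ k, ρ (k + 1) = (1 / 2 : ℂ) • (U₀ * ρ k * U₀ᴴ + U₁ * ρ k * U₁ᴴ))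
    (hmeas : ∀ k < n, p ≤ (((1 - P) * (U₀ * ρ k * U₀ᴴ)).trace).re ∧
                      p ≤ ((P * (U₁ * ρ k * U₁ᴴ)).trace).re) :
    n * (Real.log 2 - Real.binEntropy p) ≤ Real.log d := by
  have hstate (k : ℕ) : (ρ k).PosSemidef ∧ (ρ k).trace = 1 := by
    induction k with
    | zero => exact ⟨hρ0, htr0⟩
    | succ k ih =>
      have htr {U : Matrix (Fin d) (Fin d) ℂ} (hU : U ∈ unitaryGroup (Fin d) ℂ) :
          (U * ρ k * Uᴴ).trace = 1 := by
        rw [trace_mul_comm, ← Matrix.mul_assoc, ← star_eq_conjTranspose,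
          mem_unitaryGroup_iff'.1 hU, Matrix.one_mul, ih.2]
      rw [hrec]
      refine ⟨((ih.1.mul_mul_conjTranspose_same U₀).add
        (ih.1.mul_mul_conjTranspose_same U₁)).smul (by positivity), ?_⟩
      rw [trace_smul, trace_add, htr hU₀, htr hU₁]
      norm_num
  have hent (k : ℕ) (hk : k ≤ n) : ∃ V ∈ unitaryGroup (Fin d) ℂ, ∃ l : Fin d → ℝ,
      (∀ i, 0 ≤ l i) ∧ ∑ i, l i = 1 ∧ ρ k = conjDiagonal V l ∧
      k * (Real.log 2 - Real.binEntropy p) ≤ ∑ i, Real.negMulLog (l i) := by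
    induction k with
    | zero =>
      obtain ⟨V, hV, l, hl, hl1, hρ⟩ := exists_eq_conjDiagonal (hstate 0).1 (hstate 0).2
      refine ⟨V, hV, l, hl, hl1, hρ, ?_⟩
      rw [Nat.cast_zero, zero_mul]
      exact Finset.sum_nonneg fun i _ => Real.negMulLog_nonneg (hl i)
        (hl1 ▸ Finset.single_le_sum (fun i _ => hl i) (Finset.mem_univ i))
    | succ k ih =>
      obtain ⟨V, hV, l, hl, hl1, hρ, hS⟩ := ih (by omega)
      obtain ⟨W, hW, m, hm, hm1, hρ'⟩ :=
        exists_eq_conjDiagonal (hstate (k + 1)).1 (hstate (k + 1)).2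
      refine ⟨W, hW, m, hm, hm1, hρ', ?_⟩
      obtain ⟨h₀, h₁⟩ := hmeas k (by omega)
      have hmix := hrec k
      rw [hρ, mul_conjDiagonal_mul_conjTranspose] at h₀ h₁
      rw [hρ', hρ, mul_conjDiagonal_mul_conjTranspose, mul_conjDiagonal_mul_conjTranspose] at hmix
      have := entropy_add_le_entropy_mixture (mul_mem hU₀ hV) (mul_mem hU₁ hV) hW hl hm hl1 hmix
        hPh hP2 hp hp1 h₀ h₁
      push_cast
      linarith
  obtain ⟨V, hV, l, hl, hl1, -, hS⟩ := hent n le_rfl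
  have : Nonempty (Fin d) := by
    by_contra h
    rw [not_nonempty_iff] at h
    simp at hl1
  simpa using hS.trans (sum_negMulLog_le_log_card hl hl1)

/-- Core of part 3 of Theorems 1 and 2: an `n`-restricted (enhanced) QFA with `d`
basis states recognizing `L_n` with probability `p > 1/2`, evolving as
`ρ_k = ½(U₀ ρ_{k−1} U₀† + U₁ ρ_{k−1} U₁†)` from a pure starting state, must have
`d ≥ 2^{(1 − H(p))·n}`. -/
theorem qfa_dimension_lower_bound {d n : ℕ} (p : ℝ) (hp : 1 / 2 < p) (hp1 : p ≤ 1)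
    (U₀ U₁ : Matrix (Fin d) (Fin d) ℂ)
    (hU₀ : U₀ ∈ Matrix.unitaryGroup (Fin d) ℂ)
    (hU₁ : U₁ ∈ Matrix.unitaryGroup (Fin d) ℂ)
    (P : Matrix (Fin d) (Fin d) ℂ) (hPh : P.IsHermitian) (hP2 : P * P = P)
    (ψ : Fin d → ℂ) (hψ : star ψ ⬝ᵥ ψ = 1)
    (ρ : ℕ → Matrix (Fin d) (Fin d) ℂ)
    (hρ0 : ρ 0 = Matrix.vecMulVec ψ (star ψ))
    (hrec : ∀ k, ρ (k + 1) = (1 / 2 : ℂ) • (U₀ * ρ k * U₀ᴴ + U₁ * ρ k * U₁ᴴ))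
    (hmeas : ∀ k < n, p ≤ (((1 - P) * (U₀ * ρ k * U₀ᴴ)).trace).re ∧
                      p ≤ ((P * (U₁ * ρ k * U₁ᴴ)).trace).re) :
    (d : ℝ) ≥ (2 : ℝ) ^ ((1 - binH p) * n) := by
  have htr0 : (ρ 0).trace = 1 := by
    rw [hρ0, trace_vecMulVec, dotProduct_comm, hψ]
  have hpsd : (ρ 0).PosSemidef := hρ0 ▸ posSemidef_vecMulVec_self_star ψ
  have hd : (0 : ℝ) < d := by
    rcases Nat.eq_zero_or_pos d with rfl | h
    · simp at hψ
    · exact_mod_cast h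
  have hlt (q : ℝ) (hq : q ∈ Set.Ioo (1 / 2) p) :
      n * (Real.log 2 - Real.binEntropy q) ≤ Real.log d :=
    natCast_mul_le_log_dimension hq.1 (hq.2.trans_le hp1) hU₀ hU₁ hPh hP2 hpsd htr0 hrec
      fun k hk => ⟨hq.2.le.trans (hmeas k hk).1, hq.2.le.trans (hmeas k hk).2⟩
  have hle : n * (Real.log 2 - Real.binEntropy p) ≤ Real.log d := by
    have hcont : Continuous fun q => n * (Real.log 2 - Real.binEntropy q) := by fun_prop
    refine closure_minimal hlt (isClosed_Iic.preimage hcont) ?_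
    rw [closure_Ioo hp.ne]
    exact Set.right_mem_Icc.2 hp.le
  rw [ge_iff_le, ← Real.log_le_log_iff (by positivity) hd, Real.log_rpow two_pos]
  rw [← binH_mul_log_two] at hle
  linarith
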